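/- arXiv:math/0403074 — 3 statements merged into one kernel-verified Lean document; each statement's English description precedes it below -/
import Mathlib

section
/- Let a, b be real numbers with 0 < a ≤ b < 1 and let ν ∈ ℝ. Then the following are equivalent: (i) for all real numbers w₁, w₂ with w₁ ≥ 0, w₂ ≥ 0 and w₁ + w₂ > 0, one has −24·ln(a/b)·(ln(a)·w₁ − ln(b)·w₂) / (ln(a·b)·(ln(a)·w₁ + ln(b)·w₂)) − 32·ν > 0; (ii) ν < −3·ln(a/b)/(4·ln(a·b)). -/
/-- For `0 < a ≤ b < 1` and `ν ∈ ℝ`, the deformed conformal scalar curvature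
`k_ν = k − 32ν` of the Gauduchon–Ornea metric is everywhere positive iff
`ν < −3·ln(a/b)/(4·ln(ab))`. -/
theorem hopf_deformed_curvature_positive_iff
    (a b : ℝ) (ha : 0 < a) (hab : a ≤ b) (hb : b < 1) (ν : ℝ) :
    (∀ w₁ w₂ : ℝ, 0 ≤ w₁ → 0 ≤ w₂ → 0 < w₁ + w₂ →
        -24 * Real.log (a / b) * (Real.log a * w₁ - Real.log b * w₂) /
          (Real.log (a * b) * (Real.log a * w₁ + Real.log b * w₂)) - 32 * ν > 0) ↔
      ν < -3 * Real.log (a / b) / (4 * Real.log (a * b)) := by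
  have hlogb : Real.log b < 0 := Real.log_neg (ha.trans_le hab) hb
  have hlog : Real.log a ≤ Real.log b := Real.log_le_log ha hab
  rw [Real.log_div ha.ne' (ha.trans_le hab).ne', Real.log_mul ha.ne' (ha.trans_le hab).ne']
  generalize Real.log a = x at *
  generalize Real.log b = y at *
  have hx : x < 0 := hlog.trans_lt hlogb
  have hxy : x + y < 0 := add_neg hx hlogb
  have hc : 0 ≤ (x - y) / (x + y) := div_nonneg_of_nonpos (sub_nonpos.2 hlog) hxy.le
  have hk (r s : ℝ) : -24 * (x - y) * r / ((x + y) * s) = -24 * ((x - y) / (x + y)) * (r / s) := by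
    rw [mul_div_mul_comm, mul_div_assoc]
  have hν : -3 * (x - y) / (4 * (x + y)) = -3 / 4 * ((x - y) / (x + y)) := mul_div_mul_comm ..
  simp only [hk, hν]
  constructor
  · intro h
    have h₁ := h 1 0 zero_le_one le_rfl (by norm_num)
    simp only [mul_one, mul_zero, sub_zero, add_zero, div_self hx.ne] at h₁
    linarith
  · intro h w₁ w₂ h₁ h₂ hw
    have hden : x * w₁ + y * w₂ < 0 := by
      rcases h₁.eq_or_lt with rfl | h₁
      · nlinarith
      · nlinarith [mul_neg_of_neg_of_pos hx h₁, mul_nonpos_of_nonpos_of_nonneg hlogb.le h₂]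
    have hr : (x * w₁ - y * w₂) / (x * w₁ + y * w₂) ≤ 1 := by
      rw [div_le_one_of_neg hden]
      nlinarith [mul_nonpos_of_nonpos_of_nonneg hlogb.le h₂]
    linarith [mul_le_mul_of_nonneg_left hr hc]
end

section
/- Let a, b be real numbers with 0 < b² < a ≤ b < 1, and let n₁, n₂ be natural numbers such that b⁸/a⁴ < a^(2n₁−1)·b^(2n₂−1) < 1 (integer power exponents 2n₁−1, 2n₂−1 ∈ ℤ, which may equal −1). Then (n₁, n₂) is one of the four pairs (0, 2), (1, 0), (1, 1), (2, 0). -/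
/-- For `0 < b² < a ≤ b < 1` and naturals `n₁, n₂` with
`b⁸/a⁴ < a^(2n₁−1)·b^(2n₂−1) < 1` (integer exponents), the pair `(n₁, n₂)` is one of
`(0,2)`, `(1,0)`, `(1,1)`, `(2,0)`. -/
theorem hopf_limiting_pairs
    (a b : ℝ) (hb0 : 0 < b) (hba : b ^ 2 < a) (hab : a ≤ b) (hb1 : b < 1)
    (n₁ n₂ : ℕ)
    (hlow : b ^ 8 / a ^ 4 < a ^ (2 * (n₁ : ℤ) - 1) * b ^ (2 * (n₂ : ℤ) - 1))
    (hhigh : a ^ (2 * (n₁ : ℤ) - 1) * b ^ (2 * (n₂ : ℤ) - 1) < 1) :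
    (n₁, n₂) = (0, 2) ∨ (n₁, n₂) = (1, 0) ∨ (n₁, n₂) = (1, 1) ∨ (n₁, n₂) = (2, 0) := by
  have ha0 : 0 < a := (pow_pos hb0 2).trans hba
  have hlogb : Real.log b < 0 := Real.log_neg hb0 hb1
  have hlogab : Real.log a ≤ Real.log b := Real.log_le_log ha0 hab
  have hlog_mul : Real.log (a ^ (2 * (n₁ : ℤ) - 1) * b ^ (2 * (n₂ : ℤ) - 1)) =
      (2 * n₁ - 1) * Real.log a + (2 * n₂ - 1) * Real.log b := by
    rw [Real.log_mul (by positivity) (by positivity), Real.log_zpow, Real.log_zpow]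
    push_cast
    ring
  have hlow_log := Real.log_lt_log (by positivity) hlow
  have hhigh_log := Real.log_neg (by positivity) hhigh
  rw [hlog_mul, Real.log_div (by positivity) (by positivity), Real.log_pow, Real.log_pow]
    at hlow_log
  rw [hlog_mul] at hhigh_log
  push_cast at hlow_log
  have hsum : n₁ + n₂ ≤ 2 := by
    by_contra! h
    have h3 : (3 : ℝ) ≤ n₁ + n₂ := by exact_mod_cast h
    have hn₁ : (0 : ℝ) ≤ n₁ := n₁.cast_nonneg
    nlinarith [mul_nonneg (by linarith : (0 : ℝ) ≤ 2 * n₁ + 3) (sub_nonneg.2 hlogab),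
      mul_nonneg (sub_nonneg.2 h3) (neg_nonneg.2 hlogb.le)]
  have h₁ : n₁ ≤ 2 := by omega
  have h₂ : n₂ ≤ 2 := by omega
  interval_cases n₁ <;> interval_cases n₂ <;> first
    | simp; done
    | omega
    | (norm_num at hhigh_log; linarith)
end

section
/- Let a, b be real numbers with 0 < a ≤ b < 1 and let n₁, n₂ be natural numbers. Then b⁸/a⁴ < a^(2n₁−1)·b^(2n₂−1) < 1 (integer power exponents 2n₁−1, 2n₂−1 ∈ ℤ) holds if and only if one of the following holds: (n₁, n₂) = (0, 2) and b^(5/3) < a; or (n₁, n₂) = (1, 0) and b^(9/5) < a < b; or (n₁, n₂) = (1, 1) and b^(7/5) < a; or (n₁, n₂) = (2, 0) and b^(9/7) < a (here b^(5/3) etc. are real powers). -/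
/-- Logarithmic form of the bound `b ^ m / a ^ k < a ^ p * b ^ q`. -/
lemma pow_div_pow_lt_zpow_mul_zpow_iff {a b : ℝ} (ha : 0 < a) (hb : 0 < b) (m k : ℕ) (p q : ℤ) :
    b ^ m / a ^ k < a ^ p * b ^ q ↔
      m * Real.log b - k * Real.log a < p * Real.log a + q * Real.log b := by
  rw [← Real.log_lt_log_iff (by positivity) (by positivity),
    Real.log_div (by positivity) (by positivity), Real.log_mul (by positivity) (by positivity),
    Real.log_pow, Real.log_pow, Real.log_zpow, Real.log_zpow]

/-- Logarithmic form of the bound `a ^ p * b ^ q < 1`. -/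
lemma zpow_mul_zpow_lt_one_iff {a b : ℝ} (ha : 0 < a) (hb : 0 < b) (p q : ℤ) :
    a ^ p * b ^ q < 1 ↔ p * Real.log a + q * Real.log b < 0 := by
  rw [← Real.log_neg_iff (by positivity), Real.log_mul (by positivity) (by positivity),
    Real.log_zpow, Real.log_zpow]


/-- For `0 < a ≤ b < 1` and naturals `n₁, n₂`:
`b⁸/a⁴ < a^(2n₁−1)·b^(2n₂−1) < 1` (integer exponents) holds iff
`(n₁,n₂) = (0,2)` and `b^(5/3) < a`, or `(n₁,n₂) = (1,0)` and `b^(9/5) < a < b`, or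
`(n₁,n₂) = (1,1)` and `b^(7/5) < a`, or `(n₁,n₂) = (2,0)` and `b^(9/7) < a`
(real powers of `b`). -/
theorem hopf_limiting_pairs_iff
    (a b : ℝ) (ha : 0 < a) (hab : a ≤ b) (hb : b < 1) (n₁ n₂ : ℕ) :
    (b ^ 8 / a ^ 4 < a ^ (2 * (n₁ : ℤ) - 1) * b ^ (2 * (n₂ : ℤ) - 1) ∧
        a ^ (2 * (n₁ : ℤ) - 1) * b ^ (2 * (n₂ : ℤ) - 1) < 1) ↔
      ((n₁, n₂) = (0, 2) ∧ b ^ ((5 : ℝ) / 3) < a) ∨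
      ((n₁, n₂) = (1, 0) ∧ b ^ ((9 : ℝ) / 5) < a ∧ a < b) ∨
      ((n₁, n₂) = (1, 1) ∧ b ^ ((7 : ℝ) / 5) < a) ∨
      ((n₁, n₂) = (2, 0) ∧ b ^ ((9 : ℝ) / 7) < a) := by
  have hb0 : 0 < b := ha.trans_le hab
  have huv : Real.log a ≤ Real.log b := Real.log_le_log ha hab
  have hv : Real.log b < 0 := Real.log_neg hb0 hb
  rw [pow_div_pow_lt_zpow_mul_zpow_iff ha hb0, zpow_mul_zpow_lt_one_iff ha hb0]
  simp only [← Real.log_lt_log_iff (Real.rpow_pos_of_pos hb0 _) ha, Real.log_rpow hb0,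
    ← Real.log_lt_log_iff ha hb0, Prod.mk.injEq]
  push_cast
  generalize Real.log a = u at *
  generalize Real.log b = v at *
  constructor
  · rintro ⟨h₁, h₂⟩
    have hn : n₁ + n₂ < 3 := by
      by_contra! h
      have h' : (3 : ℝ) ≤ n₁ + n₂ := by exact_mod_cast h
      nlinarith [mul_nonneg (by positivity : (0 : ℝ) ≤ 2 * n₁ + 3) (sub_nonneg.2 huv),
        mul_nonneg (sub_nonneg.2 h') (neg_pos.2 hv).le]
    have hn₁ : n₁ < 3 := by omega
    have hn₂ : n₂ < 3 := by omega
    interval_cases n₁ <;> interval_cases n₂ <;> norm_num at hn <;> norm_num at h₁ h₂ ⊢ <;>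
      first
      | linarith
      | (constructor <;> linarith)
  · rintro (⟨⟨rfl, rfl⟩, h⟩ | ⟨⟨rfl, rfl⟩, h, h'⟩ | ⟨⟨rfl, rfl⟩, h⟩ | ⟨⟨rfl, rfl⟩, h⟩) <;>
      norm_num <;> constructor <;> linarith
end
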